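/- Define m_{0,k} = 1 if k = 0 and m_{0,k} = 0 if k ≥ 1, and recursively m_{n+1,k} = (m_{n,0} + m_{n,1} + ⋯ + m_{n,k})^{−1} for n ≥ 0. Then for each fixed k: the sequence (m_{2n,k})_n is nondecreasing, the sequence (m_{2n+1,k})_n is nonincreasing, and both converge to m_k as n → ∞. Moreover, for each fixed n ≥ 2, lim_{k→∞} m_{n,k} = 0. -/

import Mathlib

open MeasureTheory Set Filter

/-- The fixed point sequence. -/
noncomputable def fpSeq : ℕ → ℝ
  | 0 => 1
  | n + 1 => (-1 + Real.sqrt (1 + 4 * fpSeq n ^ 2)) / (2 * fpSeq n)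

/-- The doubly indexed sequence `m_{n,k}`: `m_{0,k} = δ_{0k}` and
`m_{n+1,k} = (m_{n,0} + ⋯ + m_{n,k})⁻¹`. -/
noncomputable def iterSeq : ℕ → ℕ → ℝ
  | 0, k => if k = 0 then 1 else 0
  | n + 1, k => (∑ j ∈ Finset.range (k + 1), iterSeq n j)⁻¹

theorem iterSeq_succ (n k : ℕ) :
    iterSeq (n + 1) k = (∑ j ∈ Finset.range (k + 1), iterSeq n j)⁻¹ := by
  rw [iterSeq]

theorem iterSeq_nonneg (n k : ℕ) : 0 ≤ iterSeq n k := by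
  induction n generalizing k with
  | zero => rw [iterSeq]; split_ifs <;> norm_num
  | succ n ih => rw [iterSeq_succ]; exact inv_nonneg.2 (Finset.sum_nonneg fun j _ => ih j)

theorem iterSeq_zero_right (n : ℕ) : iterSeq n 0 = 1 := by
  induction n with
  | zero => simp [iterSeq]
  | succ n ih => simp [iterSeq_succ, ih]

theorem one_le_sum_iterSeq (n k : ℕ) : 1 ≤ ∑ j ∈ Finset.range (k + 1), iterSeq n j := by
  rw [← iterSeq_zero_right n]
  exact Finset.single_le_sum (f := iterSeq n) (fun j _ => iterSeq_nonneg n j) (by simp)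

theorem iterSeq_le_one (n k : ℕ) : iterSeq n k ≤ 1 := by
  cases n with
  | zero => rw [iterSeq]; split_ifs <;> norm_num
  | succ n => rw [iterSeq_succ]; exact inv_le_one_of_one_le₀ (one_le_sum_iterSeq n k)

theorem iterSeq_succ_mul_sum (n k : ℕ) :
    iterSeq (n + 1) k * ∑ j ∈ Finset.range (k + 1), iterSeq n j = 1 := by
  rw [iterSeq_succ]
  exact inv_mul_cancel₀ (zero_lt_one.trans_le (one_le_sum_iterSeq n k)).ne'

theorem iterSeq_succ_le_succ {m n : ℕ} (h : ∀ k, iterSeq m k ≤ iterSeq n k) (k : ℕ) :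
    iterSeq (n + 1) k ≤ iterSeq (m + 1) k := by
  rw [iterSeq_succ, iterSeq_succ]
  exact inv_anti₀ (zero_lt_one.trans_le (one_le_sum_iterSeq m k))
    (Finset.sum_le_sum fun j _ => h j)

theorem iterSeq_even_le (n k : ℕ) : iterSeq (2 * n) k ≤ iterSeq (2 * n + 2) k := by
  induction n generalizing k with
  | zero =>
    cases k with
    | zero => simp [iterSeq_zero_right]
    | succ k => simpa [iterSeq] using iterSeq_nonneg 2 (k + 1)
  | succ n ih => exact iterSeq_succ_le_succ (iterSeq_succ_le_succ ih) k

theorem monotone_iterSeq_even (k : ℕ) : Monotone fun n : ℕ => iterSeq (2 * n) k :=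
  monotone_nat_of_le_succ fun n => iterSeq_even_le n k

theorem antitone_iterSeq_odd (k : ℕ) : Antitone fun n : ℕ => iterSeq (2 * n + 1) k :=
  antitone_nat_of_succ_le fun n => iterSeq_succ_le_succ (iterSeq_even_le n) k

theorem fpSeq_pos (k : ℕ) : 0 < fpSeq k := by
  induction k with
  | zero => simp [fpSeq]
  | succ k ih =>
    rw [fpSeq]
    have h : 1 < Real.sqrt (1 + 4 * fpSeq k ^ 2) :=
      Real.lt_sqrt_of_sq_lt (by nlinarith [sq_pos_of_pos ih])
    exact div_pos (by linarith) (by linarith)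

theorem fpSeq_succ_mul (k : ℕ) : fpSeq (k + 1) * (1 + fpSeq k * fpSeq (k + 1)) = fpSeq k := by
  have hk := fpSeq_pos k
  have hs : Real.sqrt (1 + 4 * fpSeq k ^ 2) ^ 2 = 1 + 4 * fpSeq k ^ 2 :=
    Real.sq_sqrt (by positivity)
  rw [fpSeq]
  field_simp
  linear_combination hs

theorem fpSeq_mul_sum (k : ℕ) : fpSeq k * ∑ j ∈ Finset.range (k + 1), fpSeq j = 1 := by
  induction k with
  | zero => simp [fpSeq]
  | succ k ih =>
    rw [Finset.sum_range_succ]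
    refine mul_left_cancel₀ (fpSeq_pos k).ne' ?_
    linear_combination fpSeq (k + 1) * ih + fpSeq_succ_mul k

/-- A pair of sequences exchanged by the recursion step agrees with the fixed point sequence. -/
theorem eq_fpSeq_of_mul_sum_eq_one {a b : ℕ → ℝ} (ha₀ : a 0 = 1) (ha : ∀ k, 0 ≤ a k)
    (hab : ∀ k, a k * ∑ j ∈ Finset.range (k + 1), b j = 1)
    (hba : ∀ k, b k * ∑ j ∈ Finset.range (k + 1), a j = 1) (k : ℕ) :
    a k = fpSeq k ∧ b k = fpSeq k := by
  induction k using Nat.strong_induction_on with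
  | _ k ih =>
    cases k with
    | zero => exact ⟨by simp [ha₀, fpSeq], by simpa [ha₀, fpSeq] using hba 0⟩
    | succ k =>
      have hA : ∑ j ∈ Finset.range (k + 1), a j = ∑ j ∈ Finset.range (k + 1), fpSeq j :=
        Finset.sum_congr rfl fun j hj => (ih j (Finset.mem_range.1 hj)).1
      have hB : ∑ j ∈ Finset.range (k + 1), b j = ∑ j ∈ Finset.range (k + 1), fpSeq j :=
        Finset.sum_congr rfl fun j hj => (ih j (Finset.mem_range.1 hj)).2
      have hF : 0 < ∑ j ∈ Finset.range (k + 1), fpSeq j :=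
        Finset.sum_pos (fun j _ => fpSeq_pos j) (by simp)
      have h₁ := hab (k + 1)
      have h₂ := hba (k + 1)
      have h₃ := fpSeq_mul_sum (k + 1)
      rw [Finset.sum_range_succ] at h₁ h₂ h₃
      rw [hB] at h₁
      rw [hA] at h₂
      have hb : b (k + 1) = a (k + 1) :=
        mul_right_cancel₀ hF.ne' (by linear_combination h₂ - h₁)
      rw [hb] at h₁ ⊢
      have hsum : 0 < (∑ j ∈ Finset.range (k + 1), fpSeq j) + a (k + 1) + fpSeq (k + 1) := by
        linarith [ha (k + 1), fpSeq_pos (k + 1)]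
      have h : a (k + 1) = fpSeq (k + 1) :=
        mul_right_cancel₀ hsum.ne' (by linear_combination h₁ - h₃)
      exact ⟨h, h⟩

theorem tendsto_iterSeq_even_odd (k : ℕ) :
    Tendsto (fun n : ℕ => iterSeq (2 * n) k) atTop (nhds (fpSeq k)) ∧
      Tendsto (fun n : ℕ => iterSeq (2 * n + 1) k) atTop (nhds (fpSeq k)) := by
  obtain ⟨a, ha⟩ : ∃ a : ℕ → ℝ, ∀ k,
      Tendsto (fun n : ℕ => iterSeq (2 * n) k) atTop (nhds (a k)) :=
    ⟨_, fun k => tendsto_atTop_ciSup (monotone_iterSeq_even k)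
      ⟨1, by rintro _ ⟨n, rfl⟩; exact iterSeq_le_one _ _⟩⟩
  obtain ⟨b, hb⟩ : ∃ b : ℕ → ℝ, ∀ k,
      Tendsto (fun n : ℕ => iterSeq (2 * n + 1) k) atTop (nhds (b k)) :=
    ⟨_, fun k => tendsto_atTop_ciInf (antitone_iterSeq_odd k)
      ⟨0, by rintro _ ⟨n, rfl⟩; exact iterSeq_nonneg _ _⟩⟩
  have ha₀ : a 0 = 1 := tendsto_nhds_unique (ha 0) (by simp [iterSeq_zero_right])
  have hba (k : ℕ) : b k * ∑ j ∈ Finset.range (k + 1), a j = 1 :=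
    tendsto_nhds_unique ((hb k).mul (tendsto_finsetSum _ fun j _ => ha j))
      (by simp [iterSeq_succ_mul_sum])
  have hab (k : ℕ) : a k * ∑ j ∈ Finset.range (k + 1), b j = 1 := by
    refine tendsto_nhds_unique
      (((ha k).comp (tendsto_add_atTop_nat 1)).mul (tendsto_finsetSum _ fun j _ => hb j)) ?_
    refine tendsto_const_nhds.congr fun n => ?_
    exact (iterSeq_succ_mul_sum (2 * n + 1) k).symm
  have hnonneg (k : ℕ) : 0 ≤ a k := ge_of_tendsto' (ha k) fun n => iterSeq_nonneg _ _
  obtain ⟨hak, hbk⟩ := eq_fpSeq_of_mul_sum_eq_one ha₀ hnonneg hab hba k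
  exact ⟨hak ▸ ha k, hbk ▸ hb k⟩

theorem one_div_le_iterSeq_succ (n k : ℕ) : 1 / ((k : ℝ) + 1) ≤ iterSeq (n + 1) k := by
  rw [iterSeq_succ, one_div]
  refine inv_anti₀ (zero_lt_one.trans_le (one_le_sum_iterSeq n k)) ?_
  simpa using Finset.sum_le_card_nsmul (Finset.range (k + 1)) (iterSeq n) 1
    fun j _ => iterSeq_le_one n j

theorem tendsto_iterSeq_add_two (n : ℕ) :
    Tendsto (fun k : ℕ => iterSeq (n + 2) k) atTop (nhds 0) := by
  simp only [iterSeq_succ (n + 1)]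
  refine tendsto_inv_atTop_zero.comp ?_
  refine tendsto_atTop_mono (fun k => Finset.sum_le_sum fun j _ => one_div_le_iterSeq_succ n j) ?_
  exact Real.tendsto_sum_range_one_div_nat_succ_atTop.comp (tendsto_add_atTop_nat 1)

theorem stmt_8 :
    (∀ k : ℕ,
      Monotone (fun n : ℕ => iterSeq (2 * n) k) ∧
      Antitone (fun n : ℕ => iterSeq (2 * n + 1) k) ∧
      Tendsto (fun n : ℕ => iterSeq (2 * n) k) atTop (nhds (fpSeq k)) ∧
      Tendsto (fun n : ℕ => iterSeq (2 * n + 1) k) atTop (nhds (fpSeq k))) ∧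
    ∀ n : ℕ, 2 ≤ n → Tendsto (fun k : ℕ => iterSeq n k) atTop (nhds 0) := by
  refine ⟨fun k => ⟨monotone_iterSeq_even k, antitone_iterSeq_odd k,
    tendsto_iterSeq_even_odd k⟩, fun n hn => ?_⟩
  obtain ⟨n, rfl⟩ := Nat.exists_eq_add_of_le' hn
  exact tendsto_iterSeq_add_two n
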